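/- Suppose M is a complex (not totally real) Galois extension of ℚ. Assume the p-adic Schanuel Conjecture. Then rk_{ℤ_p}(\overline{Δ_Γ(Y)}) ≥ r − (t−1)^+. -/

import Mathlib

open scoped NumberField
open Filter IsDedekindDomain

/-- The `p`-adic logarithm on a complete normed field `Cp` (a stand-in for `ℂ_p`), defined by
the power series `log_p x = ∑_{k ≥ 1} (-1)^(k+1) (x-1)^k / k` (convergent for `‖x - 1‖ < 1`). -/
noncomputable def plog (Cp : Type*) [NormedField Cp] (x : Cp) : Cp :=
  ∑' k : ℕ, (-1) ^ (k + 1 + 1) * (x - 1) ^ (k + 1) / ((k : Cp) + 1)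

/-- The `p`-adic Schanuel conjecture. -/
def PadicSchanuel (Cp : Type*) [NormedField Cp] [CharZero Cp] : Prop :=
  ∀ (m : ℕ) (α : Fin m → Cp),
    (∀ i, IsAlgebraic ℚ (α i)) → (∀ i, ‖α i - 1‖ < 1) →
    LinearIndependent ℚ (fun i => plog Cp (α i)) →
    AlgebraicIndependent ℚ (fun i => plog Cp (α i))

variable (p : ℕ) [Fact p.Prime] (M : Type*) [Field M] [NumberField M] [IsGalois ℚ M]

/-- The image of a global unit in the completion `M_𝔭`. -/
noncomputable def locEmb (v : HeightOneSpectrum (𝓞 M)) (u : (𝓞 M)ˣ) :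
    v.adicCompletion M :=
  algebraMap M (v.adicCompletion M) (algebraMap (𝓞 M) M u)

/-- `u ∈ Y = Δ_Γ⁻¹(∏_{𝔭∈Γ} O^*_{𝔭,1})`: the image of `u` in `O_𝔭^*` is a principal local
unit for every `𝔭 ∈ Γ`. -/
def MemY (Γ : Set (HeightOneSpectrum (𝓞 M))) (u : (𝓞 M)ˣ) : Prop :=
  ∀ v ∈ Γ, Valued.v (locEmb M v u - 1) < (1 : WithZero (Multiplicative ℤ))

/-- `ZpRel p M Γ u a` says that `∏ⱼ Δ_Γ(uⱼ)^{aⱼ} = 1` in `∏_{𝔭∈Γ} M_𝔭`, the `ℤ_p`-powers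
being defined by continuity. -/
def ZpRel (Γ : Set (HeightOneSpectrum (𝓞 M))) {k : ℕ} (u : Fin k → (𝓞 M)ˣ)
    (a : Fin k → ℤ_[p]) : Prop :=
  ∃ c : ℕ → Fin k → ℤ,
    (∀ j, Tendsto (fun m => ((c m j : ℤ_[p]))) atTop (nhds (a j))) ∧
    ∀ v ∈ Γ, Tendsto (fun m => ∏ j, (locEmb M v (u j)) ^ (c m j)) atTop (nhds 1)

/-- The `ℤ_p`-rank of the topological closure of `Δ_Γ(Y)` in `∏_{𝔭∈Γ} O^*_{𝔭,1}`: the largest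
`k` for which there exist `u₁, …, u_k ∈ Y` whose images under `Δ_Γ` are `ℤ_p`-linearly
independent. -/
noncomputable def ZpRankClosure (Γ : Set (HeightOneSpectrum (𝓞 M))) : ℕ :=
  sSup {k : ℕ | ∃ u : Fin k → (𝓞 M)ˣ, (∀ j, MemY M Γ (u j)) ∧
    ∀ a : Fin k → ℤ_[p], ZpRel p M Γ u a → a = 0}

/-- The Galois action on the ring of integers of `M`. -/
noncomputable def gOhom (g : M ≃ₐ[ℚ] M) : 𝓞 M →+* 𝓞 M :=
  ((galRestrict ℤ ℚ M (𝓞 M)) g).toAlgHom.toRingHom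

/-- The subset `S_p = {σ₀ ∘ g : g ∈ G, g⁻¹(𝔭₀) ∈ Γ} ⊆ E_p` determined by `Γ`, where
`σ₀ : M → M_{𝔭₀} → ℂ_p` is the composite of the canonical map with `ι`. -/
def SpOfGamma (Cp : Type*) [Field Cp] (Γ : Set (HeightOneSpectrum (𝓞 M)))
    (v0 : HeightOneSpectrum (𝓞 M)) (ι : v0.adicCompletion M →+* Cp) :
    Set (M →+* Cp) :=
  {σ | ∃ g : M ≃ₐ[ℚ] M,
    σ = (ι.comp (algebraMap M (v0.adicCompletion M))).comp (g : M →+* M) ∧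
    ∃ w ∈ Γ, w.asIdeal = Ideal.comap (gOhom M g) v0.asIdeal}

/-- `c ∈ G` is induced by complex conjugation: `τ ∘ c = conj ∘ τ` for some `τ ∈ E`. -/
def InducedByConj (g : M ≃ₐ[ℚ] M) : Prop :=
  ∃ τ : M →+* ℂ, ∀ x : M, τ (g x) = (starRingEnd ℂ) (τ x)

/-- `J_σ = {g ∈ G : σ ∘ g ∈ E_p ∖ S_p}`. -/
def Jset (Cp : Type*) [Field Cp] (Sp : Set (M →+* Cp)) (σ : M →+* Cp) :
    Set (M ≃ₐ[ℚ] M) :=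
  {g | σ.comp (g : M →+* M) ∉ Sp}

/-- `t_c`: the number of right cosets `{g, cg}` of `{id, c}` contained in `J`. -/
noncomputable def tcos (c : M ≃ₐ[ℚ] M) (J : Set (M ≃ₐ[ℚ] M)) : ℕ :=
  Set.ncard {s : Set (M ≃ₐ[ℚ] M) | (∃ g, s = {g, c * g}) ∧ s ⊆ J}

section PadicLog

variable {Cp : Type*} [NormedField Cp] [Algebra ℚ_[p] Cp]

theorem norm_natCast_of_padic (hpadic : ∀ x : ℚ_[p], ‖algebraMap ℚ_[p] Cp x‖ = ‖x‖) (n : ℕ) :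
    ‖(n : Cp)‖ = ‖(n : ℚ_[p])‖ := by
  rw [← hpadic, map_natCast]

theorem isUltrametricDist_of_padic (hpadic : ∀ x : ℚ_[p], ‖algebraMap ℚ_[p] Cp x‖ = ‖x‖) :
    IsUltrametricDist Cp := by
  refine IsUltrametricDist.isUltrametricDist_of_forall_norm_natCast_le_one fun n => ?_
  rw [norm_natCast_of_padic p hpadic]
  exact IsUltrametricDist.norm_natCast_le_one _ n

theorem norm_prime_lt_one (hpadic : ∀ x : ℚ_[p], ‖algebraMap ℚ_[p] Cp x‖ = ‖x‖) :
    ‖(p : Cp)‖ < 1 := by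
  rw [norm_natCast_of_padic p hpadic]
  exact Padic.norm_p_lt_one

theorem one_le_mul_norm_natCast (hpadic : ∀ x : ℚ_[p], ‖algebraMap ℚ_[p] Cp x‖ = ‖x‖)
    {n : ℕ} (hn : n ≠ 0) : 1 ≤ n * ‖(n : Cp)‖ := by
  have hdvd : p ^ padicValNat p n ≤ n := Nat.le_of_dvd (Nat.pos_of_ne_zero hn) pow_padicValNat_dvd
  have hp : (0 : ℝ) < (p : ℝ) ^ padicValNat p n :=
    pow_pos (mod_cast (Fact.out : p.Prime).pos) _
  have hnorm : ‖(n : Cp)‖ = ((p : ℝ) ^ padicValNat p n)⁻¹ := by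
    rw [norm_natCast_of_padic p hpadic, Padic.norm_eq_zpow_neg_valuation (mod_cast hn)]
    simp
  rw [hnorm, ← div_eq_mul_inv, one_le_div hp]
  exact_mod_cast hdvd

theorem tendsto_choose_prime_pow (hpadic : ∀ x : ℚ_[p], ‖algebraMap ℚ_[p] Cp x‖ = ‖x‖) [CharZero Cp]
    (k : ℕ) :
    Tendsto (fun n : ℕ => (((p ^ n - 1).choose k : ℕ) : Cp)) atTop (nhds ((-1) ^ k)) := by
  have hpow : Tendsto (fun n : ℕ => (p : Cp) ^ n) atTop (nhds 0) :=
    tendsto_pow_atTop_nhds_zero_of_norm_lt_one (norm_prime_lt_one p hpadic)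
  induction k with
  | zero => simp
  | succ k ih =>
    have hpos (n : ℕ) : 0 < p ^ n := pow_pos (Fact.out : p.Prime).pos n
    have hk : ((k : Cp) + 1) ≠ 0 := mod_cast k.succ_ne_zero
    have key (n : ℕ) : (((p ^ n - 1).choose (k + 1) : ℕ) : Cp) =
        (p : Cp) ^ n * ((p ^ n - 1).choose k : ℕ) / (k + 1) - ((p ^ n - 1).choose k : ℕ) := by
      obtain ⟨m, hm⟩ : ∃ m, p ^ n = m + 1 := ⟨p ^ n - 1, by have := hpos n; omega⟩
      have h1 : ((m + 1 : ℕ) : Cp) * (m.choose k : ℕ) =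
          (m.choose k + m.choose (k + 1) : ℕ) * ((k + 1 : ℕ) : Cp) := by
        rw [← Nat.choose_succ_succ]
        exact_mod_cast Nat.add_one_mul_choose_eq m k
      have h2 : (p : Cp) ^ n = ((m + 1 : ℕ) : Cp) := by rw [← hm]; push_cast; rfl
      rw [h2, hm, Nat.add_sub_cancel, h1]
      push_cast
      field_simp
      ring
    simp_rw [key]
    have := ((hpow.mul ih).div_const ((k : Cp) + 1)).sub ih
    simpa [pow_succ] using this

theorem summable_natCast_mul_pow_succ {r : ℝ} (h0 : 0 ≤ r) (h1 : r < 1) :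
    Summable fun k : ℕ => ((k : ℝ) + 1) * r ^ (k + 1) := by
  have := (summable_nat_add_iff 1).2
    (summable_pow_mul_geometric_of_norm_lt_one (R := ℝ) 1 (r := r) (by rwa [Real.norm_of_nonneg h0]))
  simpa using this

theorem norm_pow_succ_div_le (hpadic : ∀ x : ℚ_[p], ‖algebraMap ℚ_[p] Cp x‖ = ‖x‖) (m k : ℕ)
    (z : Cp) : ‖(m : Cp) * z ^ (k + 1) / ((k : Cp) + 1)‖ ≤ ((k : ℝ) + 1) * ‖z‖ ^ (k + 1) := by
  have := isUltrametricDist_of_padic p hpadic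
  have h1 := one_le_mul_norm_natCast p hpadic k.succ_ne_zero
  have h2 : ‖(m : Cp)‖ ≤ 1 := IsUltrametricDist.norm_natCast_le_one _ m
  push_cast at h1
  have h0 : 0 < ‖(k : Cp) + 1‖ := by
    by_contra! h
    nlinarith [show (0 : ℝ) < k + 1 by positivity]
  rw [norm_div, norm_mul, norm_pow, div_le_iff₀ h0]
  calc ‖(m : Cp)‖ * ‖z‖ ^ (k + 1) ≤ 1 * ‖z‖ ^ (k + 1) := by gcongr
    _ ≤ (((k : ℝ) + 1) * ‖(k : Cp) + 1‖) * ‖z‖ ^ (k + 1) := by gcongr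
    _ = _ := by ring

theorem pow_sub_one_div_eq_sum [CharZero Cp] (z : Cp) {m : ℕ} (hm : m ≠ 0) :
    ((1 + z) ^ m - 1) / m =
      ∑ k ∈ Finset.range m, ((m - 1).choose k : Cp) * z ^ (k + 1) / ((k : Cp) + 1) := by
  obtain ⟨l, rfl⟩ := Nat.exists_eq_succ_of_ne_zero hm
  have hl : ((l.succ : ℕ) : Cp) ≠ 0 := mod_cast hm
  rw [div_eq_iff hl, add_comm, add_pow, Finset.sum_range_succ']
  simp only [one_pow, mul_one, pow_zero, Nat.choose_zero_right, Nat.cast_one, add_sub_cancel_right]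
  rw [Finset.sum_mul]
  refine Finset.sum_congr rfl fun k _ => ?_
  have hk : ((k : Cp) + 1) ≠ 0 := mod_cast k.succ_ne_zero
  have h : ((l + 1 : ℕ) : Cp) * (l.choose k : ℕ) = ((l + 1).choose (k + 1) : ℕ) * ((k + 1 : ℕ) : Cp) :=
    mod_cast Nat.add_one_mul_choose_eq l k
  push_cast at h
  simp only [Nat.succ_eq_add_one, Nat.add_sub_cancel]
  push_cast
  field_simp
  linear_combination (-(z ^ (k + 1))) * h

theorem tendsto_plog [CompleteSpace Cp] [CharZero Cp]
    (hpadic : ∀ x : ℚ_[p], ‖algebraMap ℚ_[p] Cp x‖ = ‖x‖) {x : Cp} (hx : ‖x - 1‖ < 1) :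
    Tendsto (fun n : ℕ => (x ^ p ^ n - 1) / (p : Cp) ^ n) atTop (nhds (plog Cp x)) := by
  have heq (n : ℕ) : (x ^ p ^ n - 1) / (p : Cp) ^ n =
      ∑' k : ℕ, ((p ^ n - 1).choose k : Cp) * (x - 1) ^ (k + 1) / ((k : Cp) + 1) := by
    have h0 : p ^ n ≠ 0 := pow_ne_zero _ (Fact.out : p.Prime).ne_zero
    have h := pow_sub_one_div_eq_sum (x - 1) h0
    rw [add_sub_cancel] at h
    push_cast at h
    rw [h, tsum_eq_sum]
    intro k hk
    rw [Nat.choose_eq_zero_of_lt (by simp at hk; omega)]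
    simp
  simp_rw [heq]
  refine tendsto_tsum_of_dominated_convergence
    (summable_natCast_mul_pow_succ (norm_nonneg (x - 1)) hx) (fun k => ?_)
    (Eventually.of_forall fun n k => norm_pow_succ_div_le p hpadic _ k _)
  have := ((tendsto_choose_prime_pow p hpadic k).mul_const ((x - 1) ^ (k + 1))).div_const
    ((k : Cp) + 1)
  simpa [pow_succ] using this

theorem plog_one : plog Cp 1 = 0 := by simp [plog]

theorem norm_mul_sub_one_lt_one [IsUltrametricDist Cp] {x y : Cp} (hx : ‖x - 1‖ < 1)
    (hy : ‖y - 1‖ < 1) : ‖x * y - 1‖ < 1 := by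
  have h : x * y - 1 = (x - 1) * (y - 1) + ((x - 1) + (y - 1)) := by ring
  rw [h]
  refine (IsUltrametricDist.norm_add_le_max _ _).trans_lt (max_lt ?_
    ((IsUltrametricDist.norm_add_le_max _ _).trans_lt (max_lt hx hy)))
  rw [norm_mul]
  nlinarith [norm_nonneg (x - 1), norm_nonneg (y - 1)]

theorem norm_inv_sub_one_lt_one [IsUltrametricDist Cp] {x : Cp} (hx : ‖x - 1‖ < 1) :
    ‖x⁻¹ - 1‖ < 1 := by
  have h1 : ‖x‖ = 1 := by
    have := IsUltrametricDist.norm_add_eq_max_of_norm_ne_norm (x := x - 1) (y := 1)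
      (by rw [norm_one]; exact hx.ne)
    rw [sub_add_cancel, norm_one, max_eq_right hx.le] at this
    exact this
  have h0 : x ≠ 0 := by rintro rfl; simp at h1
  have : x⁻¹ - 1 = -(x - 1) * x⁻¹ := by field_simp; ring
  rw [this, norm_mul, norm_inv, h1, norm_neg]
  simpa using hx

variable [CompleteSpace Cp] [CharZero Cp]

theorem tendsto_pow_prime_pow (hpadic : ∀ x : ℚ_[p], ‖algebraMap ℚ_[p] Cp x‖ = ‖x‖) {x : Cp}
    (hx : ‖x - 1‖ < 1) : Tendsto (fun n : ℕ => x ^ p ^ n) atTop (nhds 1) := by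
  have hpow : Tendsto (fun n : ℕ => (p : Cp) ^ n) atTop (nhds 0) :=
    tendsto_pow_atTop_nhds_zero_of_norm_lt_one (norm_prime_lt_one p hpadic)
  have h := ((tendsto_plog p hpadic hx).mul hpow).add_const 1
  have hp0 : (p : Cp) ≠ 0 := mod_cast (Fact.out : p.Prime).ne_zero
  rw [mul_zero, zero_add] at h
  refine h.congr fun n => ?_
  rw [div_mul_cancel₀ _ (pow_ne_zero n hp0), sub_add_cancel]

theorem plog_mul (hpadic : ∀ x : ℚ_[p], ‖algebraMap ℚ_[p] Cp x‖ = ‖x‖) {x y : Cp}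
    (hx : ‖x - 1‖ < 1) (hy : ‖y - 1‖ < 1) : plog Cp (x * y) = plog Cp x + plog Cp y := by
  have := isUltrametricDist_of_padic p hpadic
  refine tendsto_nhds_unique (tendsto_plog p hpadic (norm_mul_sub_one_lt_one hx hy)) ?_
  have h := ((tendsto_pow_prime_pow p hpadic hy).mul (tendsto_plog p hpadic hx)).add
    (tendsto_plog p hpadic hy)
  rw [one_mul] at h
  refine h.congr fun n => ?_
  rw [mul_pow]
  ring

variable (Cp) in
/-- The multiplicative group of principal units of an ultrametric field. -/
def principalUnits [IsUltrametricDist Cp] : Subgroup Cpˣ where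
  carrier := {x | ‖(x : Cp) - 1‖ < 1}
  mul_mem' hx hy := by
    simp only [Set.mem_ofPred_eq, Units.val_mul] at *
    exact norm_mul_sub_one_lt_one hx hy
  one_mem' := by simp
  inv_mem' hx := by
    simp only [Set.mem_ofPred_eq, Units.val_inv_eq_inv_val] at *
    exact norm_inv_sub_one_lt_one hx

/-- The `p`-adic logarithm as a homomorphism on principal units. -/
noncomputable def plogHom [IsUltrametricDist Cp]
    (hpadic : ∀ x : ℚ_[p], ‖algebraMap ℚ_[p] Cp x‖ = ‖x‖) :
    principalUnits Cp →* Multiplicative Cp where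
  toFun x := Multiplicative.ofAdd (plog Cp ((x : Cpˣ) : Cp))
  map_one' := by simp [plog_one]
  map_mul' x y := by
    rw [← ofAdd_add, ← plog_mul p hpadic x.2 y.2]
    simp

theorem norm_plog_of_norm_lt (hpadic : ∀ x : ℚ_[p], ‖algebraMap ℚ_[p] Cp x‖ = ‖x‖) {x : Cp}
    (hx : ‖x - 1‖ < 1 / 4) : ‖plog Cp x‖ = ‖x - 1‖ := by
  have := isUltrametricDist_of_padic p hpadic
  by_cases h0 : x = 1
  · simp [h0, plog_one]
  have hpos : 0 < ‖x - 1‖ := norm_pos_iff.2 (sub_ne_zero.2 h0)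
  refine tendsto_nhds_unique (tendsto_plog p hpadic (hx.trans (by norm_num))).norm
    (tendsto_const_nhds.congr fun n => ?_)
  have hn : p ^ n ≠ 0 := pow_ne_zero _ (Fact.out : p.Prime).ne_zero
  have h := pow_sub_one_div_eq_sum (x - 1) hn
  obtain ⟨m, hm⟩ := Nat.exists_eq_succ_of_ne_zero hn
  rw [add_sub_cancel] at h
  push_cast at h
  rw [h, hm, Finset.sum_range_succ', add_comm]
  have hlt : ‖∑ k ∈ Finset.range m, ((m.succ - 1).choose (k + 1) : Cp) * (x - 1) ^ (k + 1 + 1) /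
      (((k + 1 : ℕ) : Cp) + 1)‖ < ‖x - 1‖ := by
    refine (IsUltrametricDist.norm_sum_le_of_forall_le_of_nonneg (C := ‖x - 1‖ / 2)
      (by positivity) fun k _ => ?_).trans_lt (by linarith)
    refine (norm_pow_succ_div_le p hpadic _ (k + 1) _).trans ?_
    have hk : ((k : ℝ) + 2) * (1 / 4) ^ k ≤ 2 := by
      have h1 : ((k : ℝ) + 2) ≤ 2 * 4 ^ k := by
        have := one_add_mul_le_pow (a := (3 : ℝ)) (by norm_num) k
        norm_num at this
        nlinarith [(k.cast_nonneg : (0 : ℝ) ≤ k)]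
      rw [one_div, inv_pow, ← div_eq_mul_inv, div_le_iff₀ (by positivity)]
      exact h1
    calc (((k + 1 : ℕ) : ℝ) + 1) * ‖x - 1‖ ^ (k + 1 + 1)
        = ((k : ℝ) + 2) * ‖x - 1‖ ^ k * ‖x - 1‖ * ‖x - 1‖ := by push_cast; ring
      _ ≤ ((k : ℝ) + 2) * (1 / 4) ^ k * (1 / 4) * ‖x - 1‖ := by gcongr
      _ ≤ 2 * (1 / 4) * ‖x - 1‖ := by gcongr
      _ = ‖x - 1‖ / 2 := by ring
  have hfirst : ‖((m.succ - 1).choose 0 : Cp) * (x - 1) ^ (0 + 1) / (((0 : ℕ) : Cp) + 1)‖ =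
      ‖x - 1‖ := by simp
  rw [IsUltrametricDist.norm_add_eq_max_of_norm_ne_norm (by rw [hfirst]; exact hlt.ne'), hfirst,
    max_eq_left hlt.le]

theorem plog_pow (hpadic : ∀ x : ℚ_[p], ‖algebraMap ℚ_[p] Cp x‖ = ‖x‖) {x : Cp}
    (hx : ‖x - 1‖ < 1) (n : ℕ) : ‖x ^ n - 1‖ < 1 ∧ plog Cp (x ^ n) = n * plog Cp x := by
  have := isUltrametricDist_of_padic p hpadic
  induction n with
  | zero => simp [plog_one]
  | succ n ih =>
    rw [pow_succ]
    refine ⟨norm_mul_sub_one_lt_one ih.1 hx, ?_⟩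
    rw [plog_mul p hpadic ih.1 hx, ih.2]
    push_cast
    ring

/-- The kernel of the `p`-adic logarithm consists of roots of unity. -/
theorem exists_pow_eq_one_of_plog_eq_zero
    (hpadic : ∀ x : ℚ_[p], ‖algebraMap ℚ_[p] Cp x‖ = ‖x‖) {x : Cp} (hx : ‖x - 1‖ < 1)
    (h : plog Cp x = 0) : ∃ n : ℕ, 0 < n ∧ x ^ n = 1 := by
  have hev := (tendsto_iff_norm_sub_tendsto_zero.1 (tendsto_pow_prime_pow p hpadic hx)).eventually
    (gt_mem_nhds (show (0 : ℝ) < 1 / 4 by norm_num))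
  obtain ⟨n, hn⟩ := hev.exists
  refine ⟨p ^ n, pow_pos (Fact.out : p.Prime).pos n, ?_⟩
  have := norm_plog_of_norm_lt p hpadic hn
  rw [(plog_pow p hpadic hx _).2, h, mul_zero, norm_zero, eq_comm, norm_eq_zero,
    sub_eq_zero] at this
  exact this

theorem tendsto_plog_nhds_one (hpadic : ∀ x : ℚ_[p], ‖algebraMap ℚ_[p] Cp x‖ = ‖x‖) :
    Tendsto (plog Cp) (nhds 1) (nhds 0) := by
  have h : Tendsto (fun x : Cp => ‖x - 1‖) (nhds 1) (nhds 0) := by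
    have : Continuous fun x : Cp => ‖x - 1‖ := by fun_prop
    simpa using this.tendsto 1
  refine tendsto_zero_iff_norm_tendsto_zero.2 (h.congr' ?_)
  filter_upwards [h.eventually (gt_mem_nhds (show (0 : ℝ) < 1 / 4 by norm_num))] with x hx
  exact (norm_plog_of_norm_lt p hpadic hx).symm

theorem plog_prod_zpow (hpadic : ∀ x : ℚ_[p], ‖algebraMap ℚ_[p] Cp x‖ = ‖x‖) {ι : Type*}
    [Fintype ι] {x : ι → Cp} (hx : ∀ i, ‖x i - 1‖ < 1) (n : ι → ℤ) :
    ‖∏ i, x i ^ n i - 1‖ < 1 ∧ plog Cp (∏ i, x i ^ n i) = ∑ i, (n i : Cp) * plog Cp (x i) := by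
  have := isUltrametricDist_of_padic p hpadic
  have h0 (i : ι) : x i ≠ 0 := fun h => by simpa [h] using hx i
  let u (i : ι) : principalUnits Cp := ⟨Units.mk0 (x i) (h0 i), hx i⟩
  have hu : (((∏ i, u i ^ n i : principalUnits Cp) : Cpˣ) : Cp) = ∏ i, x i ^ n i := by
    simp [u]
  have hlog := map_prod (plogHom p hpadic) (fun i => u i ^ n i) Finset.univ
  simp_rw [map_zpow] at hlog
  refine ⟨hu ▸ (∏ i, u i ^ n i : principalUnits Cp).2, ?_⟩
  rw [← hu]
  have := congrArg Multiplicative.toAdd hlog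
  simp only [toAdd_prod, toAdd_zpow, zsmul_eq_mul] at this
  exact this

end PadicLog

section PadicEmbeddings

variable {Cp : Type*} [NormedField Cp]

theorem norm_ringOfIntegers_le_one [IsUltrametricDist Cp] {K : Type*} [Field K] (σ : K →+* Cp)
    (x : 𝓞 K) : ‖σ (x : K)‖ ≤ 1 := by
  have hx : IsIntegral ℤ (σ (x : K)) := x.isIntegral_coe.map σ.toIntAlgHom
  have hv := Valuation.integer.integers (NormedField.valuation (K := Cp))
  exact hv.mem_of_integral hx.tower_top

theorem norm_le_one_of_valuation_le_one [IsUltrametricDist Cp] {K : Type*} [Field K]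
    [NumberField K] {σ : K →+* Cp} {w : HeightOneSpectrum (𝓞 K)}
    (hσ : ∀ x : 𝓞 K, ‖σ (x : K)‖ < 1 → x ∈ w.asIdeal) {y : K} (hy : w.valuation K y ≤ 1) :
    ‖σ y‖ ≤ 1 := by
  obtain ⟨n, d, h⟩ := w.exists_primeCompl_mul_eq_of_integer y hy
  have hd : ‖σ ((d : 𝓞 K) : K)‖ = 1 :=
    le_antisymm (norm_ringOfIntegers_le_one σ _) (not_lt.1 fun h => d.2 (hσ _ h))
  have := congrArg (fun z => ‖σ z‖) h
  simp only [map_mul, norm_mul] at this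
  rw [hd, mul_one] at this
  exact this ▸ norm_ringOfIntegers_le_one σ n

theorem tendsto_embedding_of_tendsto_adicCompletion [IsUltrametricDist Cp] {K : Type*} [Field K]
    [NumberField K] {σ : K →+* Cp} {w : HeightOneSpectrum (𝓞 K)}
    (hσ : ∀ x : 𝓞 K, ‖σ (x : K)‖ < 1 → x ∈ w.asIdeal)
    (hp : ‖(p : Cp)‖ < 1) {y : ℕ → K}
    (hy : Tendsto (fun m => algebraMap K (w.adicCompletion K) (y m)) atTop (nhds 1)) :
    Tendsto (fun m => σ (y m)) atTop (nhds 1) := by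
  rw [Metric.tendsto_atTop']
  intro ε hε
  obtain ⟨N, hN⟩ := exists_pow_lt_of_lt_one hε hp
  have hpK : (p : K) ^ N ≠ 0 := pow_ne_zero _ (mod_cast (Fact.out : p.Prime).ne_zero)
  let q : w.adicCompletion K := algebraMap K _ ((p : K) ^ N)
  have hq : (Valued.v : Valuation (w.adicCompletion K) _).restrict q ≠ 0 :=
    (Valuation.ne_zero_iff _).2 ((map_ne_zero _).2 hpK)
  have hnhds : {z : w.adicCompletion K | Valued.v (z - 1) < Valued.v q} ∈ nhds 1 := by
    rw [Valued.mem_nhds]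
    exact ⟨Units.mk0 _ hq, fun z hz => (Valuation.restrict_lt_iff _).1 hz⟩
  obtain ⟨m₀, hm₀⟩ := eventually_atTop.1 (hy.eventually hnhds)
  refine ⟨m₀, fun m hm => ?_⟩
  have h : w.valuation K (y m - 1) < w.valuation K ((p : K) ^ N) := by
    have h1 : Valued.v (algebraMap K (w.adicCompletion K) (y m) - 1) < Valued.v q := hm₀ m hm.le
    rw [← map_one (algebraMap K (w.adicCompletion K)), ← map_sub] at h1
    rwa [← HeightOneSpectrum.valuedAdicCompletion_eq_valuation',
      ← HeightOneSpectrum.valuedAdicCompletion_eq_valuation']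
  have h2 : w.valuation K ((y m - 1) / (p : K) ^ N) ≤ 1 := by
    rw [map_div₀]
    exact div_le_one_of_le₀ h.le zero_le
  have h3 := norm_le_one_of_valuation_le_one hσ h2
  rw [map_div₀, norm_div, map_sub, map_one, map_pow, map_natCast, norm_pow] at h3
  rw [dist_eq_norm]
  have hpos : 0 < ‖(p : Cp)‖ ^ N := by
    rw [← norm_pow, ← map_natCast σ, ← map_pow]
    exact norm_pos_iff.2 ((map_ne_zero σ).2 hpK)
  exact ((div_le_one hpos).1 h3).trans_lt hN

/-- The prime of `𝓞 K` cut out by an embedding into an ultrametric field. -/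
def primeOfEmbedding [IsUltrametricDist Cp] {K : Type*} [Field K] (σ : K →+* Cp) :
    Ideal (𝓞 K) where
  carrier := {x | ‖σ (x : K)‖ < 1}
  add_mem' {x y} hx hy := by
    simp only [Set.mem_ofPred_eq, map_add] at *
    exact (IsUltrametricDist.norm_add_le_max _ _).trans_lt (max_lt hx hy)
  zero_mem' := by simp
  smul_mem' c x hx := by
    simp only [Set.mem_ofPred_eq, smul_eq_mul, map_mul, norm_mul] at *
    exact mul_lt_one_of_nonneg_of_lt_one_right (norm_ringOfIntegers_le_one σ c) (norm_nonneg _) hx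

theorem mem_primeOfEmbedding [IsUltrametricDist Cp] {K : Type*} [Field K] (σ : K →+* Cp)
    (x : 𝓞 K) : x ∈ primeOfEmbedding σ ↔ ‖σ (x : K)‖ < 1 := Iff.rfl

instance [IsUltrametricDist Cp] {K : Type*} [Field K] (σ : K →+* Cp) :
    (primeOfEmbedding σ).IsPrime where
  ne_top' := by
    rw [Ideal.ne_top_iff_one, mem_primeOfEmbedding]
    simp
  mem_or_mem' {x y} h := by
    have h : ‖σ (x : K) * σ (y : K)‖ < 1 := by rw [← map_mul]; exact h
    rw [norm_mul] at h
    simp only [mem_primeOfEmbedding]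
    by_contra! h'
    exact absurd h (not_lt.2 (one_le_mul_of_one_le_of_one_le h'.1 h'.2))

theorem under_int_eq_span_prime {R : Type*} [CommRing R] (P : Ideal R) [P.IsPrime]
    (hP : (p : R) ∈ P) : P.under ℤ = Ideal.span {(p : ℤ)} := by
  have hmax : (Ideal.span {(p : ℤ)}).IsMaximal :=
    Ideal.IsPrime.isMaximal ((Ideal.span_singleton_prime
      (mod_cast (Fact.out : p.Prime).ne_zero)).2 (Nat.prime_iff_prime_int.1 Fact.out))
      (by simp [(Fact.out : p.Prime).ne_zero])
  refine (hmax.eq_of_le (Ideal.IsPrime.ne_top inferInstance) ?_).symm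
  rw [Ideal.span_singleton_le_iff_mem, Ideal.under_def, Ideal.mem_comap]
  simpa using hP

variable {M}

/-- Composing with a Galois automorphism, one can make an embedding induce any given prime
above `p`. -/
theorem exists_galois_norm_lt_one_iff [IsUltrametricDist Cp] (hp : ‖(p : Cp)‖ < 1)
    (σ : M →+* Cp) {P : Ideal (𝓞 M)} [P.IsPrime] (hP : (p : 𝓞 M) ∈ P) :
    ∃ h : M ≃ₐ[ℚ] M, ∀ x : 𝓞 M, ‖σ (h (x : M))‖ < 1 ↔ x ∈ P := by
  have hunder : (primeOfEmbedding σ).under ℤ = P.under ℤ := by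
    rw [under_int_eq_span_prime p P hP, under_int_eq_span_prime p]
    simpa [mem_primeOfEmbedding] using hp
  obtain ⟨g, hg⟩ := Algebra.IsInvariant.exists_smul_of_under_eq ℤ (𝓞 M) (M ≃ₐ[ℚ] M)
    (primeOfEmbedding σ) P hunder
  refine ⟨g⁻¹, fun x => ?_⟩
  rw [hg, Ideal.mem_pointwise_smul_iff_inv_smul_mem, mem_primeOfEmbedding]
  rfl

theorem exists_comp_galois_eq {F : Type*} [Field F] (e : F ≃+* ℂ) (φ ψ : M →+* F) :
    ∃ s : M ≃ₐ[ℚ] M, φ.comp (s : M →+* M) = ψ := by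
  obtain ⟨s, hs⟩ := NumberField.ComplexEmbedding.exists_comp_symm_eq_of_comp_eq (k := ℚ)
    (e.toRingHom.comp φ) (e.toRingHom.comp ψ) (Subsingleton.elim _ _)
  refine ⟨s.symm, RingHom.ext fun x => e.injective ?_⟩
  exact congrArg (fun f => f x) hs

theorem coe_gOhom_apply (g : M ≃ₐ[ℚ] M) (x : 𝓞 M) : ((gOhom M g x : 𝓞 M) : M) = g (x : M) :=
  algebraMap_galRestrict_apply ℤ g x

end PadicEmbeddings

section Regulator

open NumberField NumberField.Units NumberField.InfinitePlace

theorem exists_submatrix_det_ne_zero {F : Type*} [Field F] {k r : ℕ}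
    {A : Matrix (Fin k) (Fin r) F} (h : LinearIndependent F A.row) :
    ∃ e : Fin k → Fin r, (A.submatrix id e).det ≠ 0 := by
  have hrank : Module.finrank F (Submodule.span F (Set.range A.col)) = k := by
    rw [← Matrix.rank_eq_finrank_span_cols, h.rank_matrix, Fintype.card_fin]
  obtain ⟨f, hf, -, hli⟩ := Submodule.exists_fun_fin_finrank_span_eq F (Set.range A.col)
  choose e he using hf
  refine ⟨e ∘ Fin.cast hrank.symm, ?_⟩
  have hcols : LinearIndependent F (A.submatrix id (e ∘ Fin.cast hrank.symm)).col := by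
    have hcol : (A.submatrix id (e ∘ Fin.cast hrank.symm)).col = f ∘ Fin.cast hrank.symm :=
      funext fun j => he (Fin.cast hrank.symm j)
    rw [hcol]
    exact hli.comp _ (Fin.cast_injective _)
  rw [Matrix.linearIndependent_cols_iff_isUnit, Matrix.isUnit_iff_isUnit_det] at hcols
  exact hcols.ne_zero

theorem linearIndependent_log_fundSystem {K : Type*} [Field K] [NumberField K]
    (w' : InfinitePlace K) :
    LinearIndependent ℝ (fun (w : {w : InfinitePlace K // w ≠ w'}) (j : Fin (rank K)) =>
      Real.log (w.1 (fundSystem K j : K))) := by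
  classical
  have hcard : Fintype.card {w : InfinitePlace K // w ≠ w'} = Fintype.card (Fin (rank K)) := by
    rw [Fintype.card_subtype_compl, Fintype.card_fin, Fintype.card_subtype_eq]
    rfl
  let e := Fintype.equivOfCardEq hcard
  have hdet := regulator_ne_zero K
  rw [regulator_eq_det K w' e, abs_ne_zero] at hdet
  rw [Fintype.linearIndependent_iff]
  intro c hc w
  have hzero := Matrix.eq_zero_of_mulVec_eq_zero hdet (v := fun w => c w / (mult w.1 : ℝ)) (by
    ext i
    have := congrFun hc (e i)
    simp only [Finset.sum_apply, Pi.smul_apply, smul_eq_mul, Pi.zero_apply] at this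
    refine Eq.trans (Finset.sum_congr rfl fun w _ => ?_) this
    have : (mult w.1 : ℝ) ≠ 0 := mult_coe_ne_zero
    simp only [Matrix.of_apply]
    field_simp)
  have := congrFun hzero w
  simpa [mult_coe_ne_zero] using this

theorem exists_linearIndependent_log_fundSystem {K : Type*} [Field K] [NumberField K]
    {S : Set (InfinitePlace K)} {k : ℕ} (hS : k ≤ S.ncard) (hk : k ≤ rank K) :
    ∃ pl : Fin k → InfinitePlace K, (∀ i, pl i ∈ S) ∧
      LinearIndependent ℝ (fun i (j : Fin (rank K)) => Real.log (pl i (fundSystem K j : K))) := by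
  classical
  obtain ⟨T, hTS, hT⟩ := Set.exists_subset_card_eq hS
  have hcard : rank K + 1 = Nat.card (InfinitePlace K) := by
    rw [Nat.card_eq_fintype_card, rank, Nat.sub_add_cancel Fintype.card_pos]
  obtain ⟨w', hw'⟩ : ∃ w', w' ∉ T := by
    by_contra! h
    rw [Set.eq_univ_of_forall h, Set.ncard_univ] at hT
    omega
  have e : Fin k ≃ T := (Fintype.equivFinOfCardEq (by
    rw [← Nat.card_eq_fintype_card, ← hT]; rfl)).symm
  let f (i : Fin k) : {w : InfinitePlace K // w ≠ w'} :=
    ⟨e i, fun h => hw' (h ▸ (e i).2)⟩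
  have hf : Function.Injective f := fun i j h => e.injective (Subtype.ext (congrArg (·.1) h))
  exact ⟨fun i => e i, fun i => hTS (e i).2, (linearIndependent_log_fundSystem w').comp f hf⟩

theorem exists_pow_unit_congr_one {K : Type*} [Field K] [NumberField K] :
    ∃ N : ℕ, N ≠ 0 ∧ (∀ u : (𝓞 K)ˣ, ∃ a : 𝓞 K, (u : 𝓞 K) ^ N = 1 + p * a) ∧
      ∀ ζ ∈ torsion K, ζ ^ N = 1 := by
  have hp : Ideal.span {(p : 𝓞 K)} ≠ ⊥ := by
    simp [(Fact.out : p.Prime).ne_zero]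
  have : Finite (𝓞 K ⧸ Ideal.span {(p : 𝓞 K)}) := Ideal.finiteQuotientOfFreeOfNeBot _ hp
  refine ⟨Nat.card (𝓞 K ⧸ Ideal.span {(p : 𝓞 K)})ˣ * torsionOrder K,
    mul_ne_zero Nat.card_pos.ne' (torsionOrder_ne_zero K), fun u => ?_, fun ζ hζ => ?_⟩
  · have h : Ideal.Quotient.mk (Ideal.span {(p : 𝓞 K)})
        ((u : 𝓞 K) ^ (Nat.card (𝓞 K ⧸ Ideal.span {(p : 𝓞 K)})ˣ * torsionOrder K) - 1) = 0 := by
      have := congrArg Units.val (pow_card_eq_one'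
        (x := Units.map (Ideal.Quotient.mk (Ideal.span {(p : 𝓞 K)})).toMonoidHom u))
      simp only [Units.val_pow_eq_pow_val, Units.coe_map, Units.val_one] at this
      rw [map_sub, map_one, map_pow, pow_mul, sub_eq_zero]
      erw [this]
      rw [one_pow]
    rw [Ideal.Quotient.eq_zero_iff_mem, Ideal.mem_span_singleton'] at h
    obtain ⟨a, ha⟩ := h
    exact ⟨a, by linear_combination -ha⟩
  · have h : (⟨ζ, hζ⟩ : torsion K) ^ torsionOrder K = 1 := pow_card_eq_one'
    rw [pow_mul', show ζ ^ torsionOrder K = 1 from congrArg Subtype.val h, one_pow]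

variable {M}

theorem mk_comp_eq_iff {c : M ≃ₐ[ℚ] M} {τ : M →+* ℂ}
    (hτ : ∀ x : M, τ (c x) = (starRingEnd ℂ) (τ x)) (g h : M ≃ₐ[ℚ] M) :
    mk (τ.comp (g : M →+* M)) = mk (τ.comp (h : M →+* M)) ↔ h = g ∨ h = c * g := by
  have inj (a b : M ≃ₐ[ℚ] M) : τ.comp (a : M →+* M) = τ.comp (b : M →+* M) ↔ b = a := by
    refine ⟨fun H => AlgEquiv.ext fun x => τ.injective ?_, fun H => by rw [H]⟩
    exact (congrArg (fun f => f x) H).symm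
  have hconj : ComplexEmbedding.conjugate (τ.comp (g : M →+* M)) =
      τ.comp ((c * g : M ≃ₐ[ℚ] M) : M →+* M) :=
    RingHom.ext fun x => (hτ (g x)).symm
  rw [mk_eq_iff, hconj, inj, inj]

theorem exists_mk_comp_eq (τ : M →+* ℂ) (w : InfinitePlace M) :
    ∃ g : M ≃ₐ[ℚ] M, mk (τ.comp (g : M →+* M)) = w := by
  obtain ⟨g, hg⟩ := exists_comp_galois_eq (RingEquiv.refl ℂ) τ w.embedding
  exact ⟨g, by rw [hg, mk_embedding]⟩

theorem exists_inducedByConj : ∃ c : M ≃ₐ[ℚ] M, InducedByConj M c := by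
  obtain ⟨τ⟩ : Nonempty (M →+* ℂ) := inferInstance
  obtain ⟨c, hc⟩ := exists_comp_galois_eq (RingEquiv.refl ℂ) τ (ComplexEmbedding.conjugate τ)
  exact ⟨c, τ, fun x => congrArg (fun f => f x) hc⟩

/-- All but at most `t_c` of the infinite places are represented by `τ ∘ g` with `g ∉ J`. -/
theorem rank_add_one_le_ncard_add_tcos {c : M ≃ₐ[ℚ] M} {τ : M →+* ℂ}
    (hτ : ∀ x : M, τ (c x) = (starRingEnd ℂ) (τ x)) (J : Set (M ≃ₐ[ℚ] M)) :
    rank M + 1 ≤ {w | ∃ g ∉ J, mk (τ.comp (g : M →+* M)) = w}.ncard + tcos M c J := by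
  classical
  set S : Set (InfinitePlace M) := {w | ∃ g ∉ J, mk (τ.comp (g : M →+* M)) = w} with hS
  have hcompl : Sᶜ.ncard ≤ tcos M c J := by
    refine Set.ncard_le_ncard_of_injOn (fun w => {g | mk (τ.comp (g : M →+* M)) = w}) ?_ ?_
      (Set.toFinite _)
    · intro w hw
      obtain ⟨g, rfl⟩ := exists_mk_comp_eq τ w
      refine ⟨⟨g, ?_⟩, fun h hh => ?_⟩
      · ext h
        simp only [Set.mem_ofPred_eq, eq_comm, Set.mem_insert_iff, Set.mem_singleton_iff]
        rw [mk_comp_eq_iff hτ, eq_comm, eq_comm (a := h)]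
      · by_contra hJ
        exact hw ⟨h, hJ, hh⟩
    · intro w _ w' _ h
      obtain ⟨g, rfl⟩ := exists_mk_comp_eq τ w
      exact h.subset rfl
  have hcard : rank M + 1 = Nat.card (InfinitePlace M) := by
    rw [Nat.card_eq_fintype_card, rank, Nat.sub_add_cancel Fintype.card_pos]
  have := Set.ncard_add_ncard_compl S
  omega

theorem exists_galois_exponents (g : M ≃ₐ[ℚ] M) (j : Fin (rank M)) :
    ∃ ζ ∈ torsion M, ∃ a : Fin (rank M) → ℤ,
      g (fundSystem M j : M) = (ζ : M) * ∏ i, (fundSystem M i : M) ^ a i := by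
  obtain ⟨⟨ζ, a⟩, h, -⟩ := exist_unique_eq_mul_prod M
    (Units.map (gOhom M g).toMonoidHom (fundSystem M j))
  refine ⟨ζ, ζ.2, a, ?_⟩
  have := congrArg (fun u : (𝓞 M)ˣ => (u : M)) h
  rw [← coe_gOhom_apply]
  simpa [NumberField.Units.coe_zpow] using this

end Regulator

section UnitRank

open NumberField NumberField.Units

theorem eq_zero_of_prod_fundSystem_zpow_mem_torsion {K : Type*} [Field K] [NumberField K]
    {n : Fin (rank K) → ℤ} (h : ∏ i, fundSystem K i ^ n i ∈ torsion K) : n = 0 := by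
  have := (exist_unique_eq_mul_prod K (∏ i, fundSystem K i ^ n i)).unique
    (y₁ := (1, n)) (y₂ := (⟨_, h⟩, 0)) (by simp) (by simp)
  exact congrArg Prod.snd this

theorem exists_prod_zpow_eq_one_of_rank_lt {K : Type*} [Field K] [NumberField K] {k : ℕ}
    (hk : rank K < k) (u : Fin k → (𝓞 K)ˣ) : ∃ n : Fin k → ℤ, n ≠ 0 ∧ ∏ i, u i ^ n i = 1 := by
  have hli : ¬ LinearIndependent ℤ (fun i => Additive.ofMul (u i)) := fun h => by
    have := h.fintype_card_le_finrank
    rw [Fintype.card_fin, NumberField.Units.finrank_eq] at this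
    omega
  rw [Fintype.linearIndependent_iff] at hli
  push Not at hli
  obtain ⟨n, hn, i, hi⟩ := hli
  refine ⟨n, fun h => hi (congrFun h i), Additive.ofMul.injective ?_⟩
  rw [ofMul_prod, ofMul_one, ← hn]
  exact Finset.sum_congr rfl fun i _ => ofMul_zpow _ _

theorem aeval_det_sum_intCast_mul_X {F : Type*} [Field F] [CharZero F] {k r : ℕ} (l : Fin r → F)
    (B : Fin k → Fin k → Fin r → ℤ) :
    MvPolynomial.aeval l
        (Matrix.of fun i j => ∑ q, (B i j q : MvPolynomial (Fin r) ℚ) * MvPolynomial.X q).det =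
      (Matrix.of fun i j => ∑ q, (B i j q : F) * l q).det := by
  rw [AlgHom.map_det]
  congr 1
  ext i j
  simp

theorem det_ne_zero_of_algebraicIndependent {F E : Type*} [Field F] [CharZero F] [Field E]
    [CharZero E] {k r : ℕ} {l : Fin r → F} (hl : AlgebraicIndependent ℚ l) {l' : Fin r → E}
    (B : Fin k → Fin k → Fin r → ℤ)
    (h : (Matrix.of fun i j => ∑ q, (B i j q : E) * l' q).det ≠ 0) :
    (Matrix.of fun i j => ∑ q, (B i j q : F) * l q).det ≠ 0 := by
  have hP :
      (Matrix.of fun i j => ∑ q, (B i j q : MvPolynomial (Fin r) ℚ) * MvPolynomial.X q).det ≠ 0 :=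
    fun h0 => h (by rw [← aeval_det_sum_intCast_mul_X, h0, map_zero])
  rw [← aeval_det_sum_intCast_mul_X]
  exact fun h0 => hP (hl (by rw [h0, map_zero]))

theorem prod_locEmb_zpow {k : ℕ} (v : HeightOneSpectrum (𝓞 M)) (u : Fin k → (𝓞 M)ˣ)
    (n : Fin k → ℤ) : ∏ j, locEmb M v (u j) ^ n j =
      algebraMap M (v.adicCompletion M) (∏ j, (u j : M) ^ n j) := by
  rw [map_prod]
  exact Finset.prod_congr rfl fun j _ => (map_zpow₀ _ _ _).symm

theorem bddAbove_zpRank {Γ : Set (HeightOneSpectrum (𝓞 M))} :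
    BddAbove {k : ℕ | ∃ u : Fin k → (𝓞 M)ˣ, (∀ j, MemY M Γ (u j)) ∧
      ∀ a : Fin k → ℤ_[p], ZpRel p M Γ u a → a = 0} := by
  refine ⟨rank M, ?_⟩
  rintro k ⟨u, -, hu⟩
  by_contra! hk
  obtain ⟨n, hn, hun⟩ := exists_prod_zpow_eq_one_of_rank_lt hk u
  have hprod : ∏ j, (u j : M) ^ n j = 1 := by
    simpa [NumberField.Units.coe_zpow] using congrArg (fun x : (𝓞 M)ˣ => (x : M)) hun
  refine hn (funext fun i => ?_)
  have := congrFun (hu (fun j => (n j : ℤ_[p])) ⟨fun _ => n, fun _ => tendsto_const_nhds,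
    fun v _ => tendsto_const_nhds.congr fun _ => ?_⟩) i
  · simpa using this
  · rw [prod_locEmb_zpow, hprod, map_one]

end UnitRank

section Main

open NumberField NumberField.Units NumberField.InfinitePlace

variable {Cp : Type*} [NormedField Cp] [CompleteSpace Cp] [CharZero Cp] [Algebra ℚ_[p] Cp]

variable {M} in
theorem eq_zero_of_zpRel (hpadic : ∀ x : ℚ_[p], ‖algebraMap ℚ_[p] Cp x‖ = ‖x‖)
    {Γ : Set (HeightOneSpectrum (𝓞 M))} {k : ℕ} {u : Fin k → (𝓞 M)ˣ} {σ : Fin k → M →+* Cp}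
    (hσ : ∀ i, ∃ w ∈ Γ, ∀ x : 𝓞 M, ‖σ i (x : M)‖ < 1 → x ∈ w.asIdeal)
    (hu : ∀ i j, ‖σ i (u j : M) - 1‖ < 1)
    (hdet : (Matrix.of fun i j => plog Cp (σ i (u j : M))).det ≠ 0)
    {a : Fin k → ℤ_[p]} (ha : ZpRel p M Γ u a) : a = 0 := by
  have := isUltrametricDist_of_padic p hpadic
  obtain ⟨c, hca, hc⟩ := ha
  have hcont : Continuous (algebraMap ℚ_[p] Cp) :=
    (AddMonoidHomClass.isometry_of_norm _ hpadic).continuous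
  have hcast (j : Fin k) :
      Tendsto (fun m => (c m j : Cp)) atTop (nhds (algebraMap ℚ_[p] Cp (a j))) := by
    refine ((hcont.comp continuous_subtype_val).continuousAt.tendsto.comp (hca j)).congr fun m => ?_
    change algebraMap ℚ_[p] Cp ((c m j : ℤ_[p]) : ℚ_[p]) = c m j
    rw [PadicInt.coe_intCast, map_intCast]
  have hzero := Matrix.eq_zero_of_mulVec_eq_zero hdet
    (v := fun j => algebraMap ℚ_[p] Cp (a j)) (by
      ext i
      obtain ⟨w, hw, hwσ⟩ := hσ i
      have h1 : Tendsto (fun m => σ i (∏ j, (u j : M) ^ c m j)) atTop (nhds 1) :=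
        tendsto_embedding_of_tendsto_adicCompletion p hwσ (norm_prime_lt_one p hpadic)
          ((hc w hw).congr fun m => prod_locEmb_zpow _ w u (c m))
      have h2 := (tendsto_plog_nhds_one p hpadic).comp h1
      have h3 : Tendsto (fun m => ∑ j, (c m j : Cp) * plog Cp (σ i (u j : M))) atTop
          (nhds (∑ j, algebraMap ℚ_[p] Cp (a j) * plog Cp (σ i (u j : M)))) :=
        tendsto_finsetSum _ fun j _ => (hcast j).mul_const _
      simp only [Matrix.mulVec, dotProduct, Matrix.of_apply, Pi.zero_apply, mul_comm (plog Cp _)]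
      refine tendsto_nhds_unique h3 (h2.congr fun m => ?_)
      rw [Function.comp_apply, map_prod, ← (plog_prod_zpow p hpadic (hu i) (c m)).2]
      simp only [map_zpow₀])
  refine funext fun j => Subtype.ext ((algebraMap ℚ_[p] Cp).injective ?_)
  simpa using congrFun hzero j

theorem linearIndependent_plog_fundSystem_pow
    (hpadic : ∀ x : ℚ_[p], ‖algebraMap ℚ_[p] Cp x‖ = ‖x‖) {K : Type*} [Field K] [NumberField K]
    (σ : K →+* Cp) {N : ℕ} (hN : N ≠ 0)
    (h : ∀ i, ‖σ ((fundSystem K i : K) ^ N) - 1‖ < 1) :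
    LinearIndependent ℚ (fun i => plog Cp (σ ((fundSystem K i : K) ^ N))) := by
  rw [← LinearIndependent.iff_fractionRing ℤ ℚ, Fintype.linearIndependent_iff]
  intro n hn
  obtain ⟨hx, hlog⟩ := plog_prod_zpow p hpadic h n
  simp only [zsmul_eq_mul] at hn
  obtain ⟨m, hm, hpow⟩ := exists_pow_eq_one_of_plog_eq_zero p hpadic hx (hlog.trans hn)
  have hK : (∏ i, ((fundSystem K i : K) ^ N) ^ n i) ^ m = 1 := σ.injective (by
    simpa only [map_pow, map_prod, map_zpow₀, map_one] using hpow)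
  have hU : (∏ i, (fundSystem K i ^ N) ^ n i) ^ m = 1 := by
    refine NumberField.Units.coe_injective K ?_
    simpa [NumberField.Units.coe_zpow] using hK
  have hmem : ∏ i, fundSystem K i ^ ((N : ℤ) * n i) ∈ torsion K := by
    simp only [zpow_mul, zpow_natCast]
    exact isOfFinOrder_iff_pow_eq_one.2 ⟨m, hm, hU⟩
  intro i
  have := congrFun (eq_zero_of_prod_fundSystem_zpow_mem_torsion hmem) i
  simpa [hN] using this

/-- The exponents of `g` on the units modulo torsion describe its effect both on complex
logarithms and on `p`-adic logarithms of the units `fundSystem M j ^ N`. -/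
theorem exists_galois_log_matrix (hpadic : ∀ x : ℚ_[p], ‖algebraMap ℚ_[p] Cp x‖ = ‖x‖)
    {N : ℕ} (hζ : ∀ ζ ∈ torsion M, ζ ^ N = 1) (σ : M →+* Cp)
    (h : ∀ i, ‖σ ((fundSystem M i : M) ^ N) - 1‖ < 1) (τ : M →+* ℂ) :
    ∃ A : (M ≃ₐ[ℚ] M) → Fin (rank M) → Fin (rank M) → ℤ,
      (∀ (g : M ≃ₐ[ℚ] M) j, Real.log (mk (τ.comp (g : M →+* M)) (fundSystem M j : M)) =
        ∑ i, (A g j i : ℝ) * Real.log (mk τ (fundSystem M i : M))) ∧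
      ∀ (g : M ≃ₐ[ℚ] M) j, plog Cp (σ (g ((fundSystem M j : M) ^ N))) =
        ∑ i, (A g j i : Cp) * plog Cp (σ ((fundSystem M i : M) ^ N)) := by
  choose ζ hζt A hA using exists_galois_exponents (M := M)
  refine ⟨A, fun g j => ?_, fun g j => ?_⟩
  · have h1 : mk (τ.comp (g : M →+* M)) (fundSystem M j : M) = mk τ (g (fundSystem M j : M)) := rfl
    rw [h1, hA, map_mul, (mem_torsion M).1 (hζt g j) (mk τ), one_mul, map_prod,
      Real.log_prod (fun i _ => by simp [zpow_ne_zero])]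
    refine Finset.sum_congr rfl fun i _ => ?_
    rw [map_zpow₀, Real.log_zpow]
  · have hone : (ζ g j : M) ^ N = 1 := by
      have := congrArg (fun x : (𝓞 M)ˣ => (x : M)) (hζ _ (hζt g j))
      simpa using this
    rw [map_pow, hA, mul_pow, hone, one_mul, ← Finset.prod_pow,
      ← (plog_prod_zpow p hpadic h (A g j)).2, map_prod]
    congr 1
    refine Finset.prod_congr rfl fun i _ => ?_
    rw [← zpow_natCast, ← zpow_natCast, zpow_comm, map_zpow₀]

variable {M} in
theorem memY_of_eq_one_add {Γ : Set (HeightOneSpectrum (𝓞 M))}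
    (hΓp : ∀ v ∈ Γ, (p : 𝓞 M) ∈ v.asIdeal) {u : (𝓞 M)ˣ} {a : 𝓞 M}
    (hu : (u : 𝓞 M) = 1 + p * a) : MemY M Γ u := by
  intro v hv
  have h1 : locEmb M v u - 1 =
      algebraMap M (v.adicCompletion M) (algebraMap (𝓞 M) M (p * a)) := by
    rw [locEmb, hu, map_add, map_add, map_one, map_one, add_sub_cancel_left]
  rw [h1]
  refine (v.valuedAdicCompletion_eq_valuation' _).trans_lt ?_
  refine (v.valuation_lt_one_iff_mem (K := M) _).2 ?_
  exact Ideal.mul_mem_right _ _ (hΓp v hv)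

variable {M} in
/-- An embedding `σ'` such that for every `g` with `σ ∘ g ∈ S_p`, the prime of `M` determined by
`σ' ∘ g` is in `Γ`. -/
theorem exists_embedding_forall_spOfGamma {Cp : Type*} [NormedField Cp] [IsUltrametricDist Cp]
    (hp : ‖(p : Cp)‖ < 1)
    (hiso : Nonempty (Cp ≃+* ℂ)) {Γ : Set (HeightOneSpectrum (𝓞 M))}
    {v0 : HeightOneSpectrum (𝓞 M)} (hv0 : (p : 𝓞 M) ∈ v0.asIdeal)
    (ι : v0.adicCompletion M →+* Cp) (σ : M →+* Cp) :
    ∃ σ' : M →+* Cp, ∀ g : M ≃ₐ[ℚ] M, σ.comp (g : M →+* M) ∈ SpOfGamma M Cp Γ v0 ι →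
      ∃ w ∈ Γ, ∀ x : 𝓞 M, ‖σ' (g (x : M))‖ < 1 → x ∈ w.asIdeal := by
  obtain ⟨e⟩ := hiso
  set σ₀ := ι.comp (algebraMap M (v0.adicCompletion M))
  obtain ⟨h, hh⟩ := exists_galois_norm_lt_one_iff p hp σ₀ hv0
  obtain ⟨s, hs⟩ := exists_comp_galois_eq e σ₀ σ
  refine ⟨(σ₀.comp (h : M →+* M)).comp (s : M →+* M), ?_⟩
  rintro g ⟨g', hg', w, hw, hwv⟩
  refine ⟨w, hw, fun x hx => ?_⟩
  have hsg (y : M) : s (g y) = g' y := σ₀.injective (by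
    have := congrArg (fun f => f y) hg'
    rw [← hs] at this
    exact this)
  have hx' : ‖σ₀ (h ((gOhom M g' x : 𝓞 M) : M))‖ < 1 := by
    rw [coe_gOhom_apply, ← hsg]
    exact hx
  rw [hwv]
  exact (hh _).1 hx'

theorem rank_sub_le_zpRankClosure (hpadic : ∀ x : ℚ_[p], ‖algebraMap ℚ_[p] Cp x‖ = ‖x‖)
    (hiso : Nonempty (Cp ≃+* ℂ)) (hSch : PadicSchanuel Cp)
    {Γ : Set (HeightOneSpectrum (𝓞 M))} (hΓp : ∀ v ∈ Γ, (p : 𝓞 M) ∈ v.asIdeal)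
    {v0 : HeightOneSpectrum (𝓞 M)} (hv0 : v0 ∈ Γ) (ι : v0.adicCompletion M →+* Cp)
    (σ : M →+* Cp) {c : M ≃ₐ[ℚ] M} (hc : InducedByConj M c) :
    rank M - (tcos M c (Jset M Cp (SpOfGamma M Cp Γ v0 ι) σ) - 1) ≤ ZpRankClosure p M Γ := by
  have := isUltrametricDist_of_padic p hpadic
  have hp := norm_prime_lt_one p hpadic
  set J := Jset M Cp (SpOfGamma M Cp Γ v0 ι) σ with hJ
  obtain ⟨τ, hτ⟩ := hc
  obtain ⟨σ', hσ'⟩ := exists_embedding_forall_spOfGamma p hp hiso (Γ := Γ) (hΓp v0 hv0) ι σ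
  obtain ⟨N, hN, hNu, hNζ⟩ := exists_pow_unit_congr_one p (K := M)
  have hnorm (φ : M →+* Cp) (u : (𝓞 M)ˣ) : ‖φ ((u : M) ^ N) - 1‖ < 1 := by
    obtain ⟨a, ha⟩ := hNu u
    have h1 : φ ((u : M) ^ N) - 1 = p * φ (a : M) := by
      have := congrArg (fun x : 𝓞 M => φ (x : M)) ha
      simp only [map_pow, map_add, map_one, map_mul, map_natCast] at this ⊢
      rw [this, add_sub_cancel_left]
    rw [h1, norm_mul]
    exact (mul_le_of_le_one_right (norm_nonneg _) (norm_ringOfIntegers_le_one φ a)).trans_lt hp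
  have hli := linearIndependent_plog_fundSystem_pow p hpadic σ' hN fun i => hnorm σ' _
  have halg := hSch _ (fun i => σ' ((fundSystem M i : M) ^ N))
    (fun i => IsAlgebraic.algHom σ'.toRatAlgHom (Algebra.IsAlgebraic.isAlgebraic _))
    (fun i => hnorm σ' _) hli
  obtain ⟨A, hAlog, hAplog⟩ :=
    exists_galois_log_matrix p M hpadic hNζ σ' (fun i => hnorm σ' _) τ
  obtain ⟨pl, hpl, hrows⟩ := exists_linearIndependent_log_fundSystem
    (S := {w | ∃ g ∉ J, mk (τ.comp (g : M →+* M)) = w}) (k := rank M - (tcos M c J - 1))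
    (by have := rank_add_one_le_ncard_add_tcos hτ J; omega) (Nat.sub_le _ _)
  choose g hgJ hg using hpl
  obtain ⟨e, he⟩ := exists_submatrix_det_ne_zero
    (A := Matrix.of fun i j => Real.log (pl i (fundSystem M j : M))) hrows
  have hdet := det_ne_zero_of_algebraicIndependent halg
    (l' := fun i => Real.log (mk τ (fundSystem M i : M))) (fun i j => A (g i) (e j)) (by
      convert he using 2
      ext i j
      simp only [Matrix.of_apply, Matrix.submatrix_apply, id, ← hg]
      exact (hAlog _ _).symm)
  refine le_csSup (bddAbove_zpRank p M) ⟨fun j => fundSystem M (e j) ^ N, fun j => ?_,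
    fun a ha => ?_⟩
  · obtain ⟨a, h⟩ := hNu (fundSystem M (e j))
    exact memY_of_eq_one_add p hΓp ((Units.val_pow_eq_pow_val _ _).trans h)
  · refine eq_zero_of_zpRel p hpadic (σ := fun i => σ'.comp (g i : M →+* M))
      (fun i => hσ' (g i) (not_not.1 (hgJ i))) (fun i j => ?_) ?_ ha
    · rw [NumberField.Units.coe_pow]
      exact hnorm _ _
    · convert hdet using 2
      ext i j
      simp only [Matrix.of_apply, NumberField.Units.coe_pow]
      exact hAplog _ _

end Main

/-- Suppose `M` is a complex (not totally real) Galois extension of `ℚ`.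
Let `Γ` be a nonempty set of primes of `O_M` above `p`, `S_p ⊆ E_p` the subset determined by
`Γ`, and `t = min_{c∈C} t_c`. Assuming the `p`-adic Schanuel conjecture, the `ℤ_p`-rank of
the closure of `Δ_Γ(Y)` is at least `r − (t−1)⁺`. -/
theorem stmt7
    (Cp : Type*) [NormedField Cp] [CompleteSpace Cp] [IsAlgClosed Cp] [CharZero Cp]
    [Algebra ℚ_[p] Cp] (hpadic : ∀ x : ℚ_[p], ‖algebraMap ℚ_[p] Cp x‖ = ‖x‖)
    (hiso : Nonempty (Cp ≃+* ℂ))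
    (hcx : ∃ (τ : M →+* ℂ) (x : M), (τ x).im ≠ 0)
    (Γ : Set (HeightOneSpectrum (𝓞 M))) (hΓne : Γ.Nonempty)
    (hΓp : ∀ v ∈ Γ, (p : 𝓞 M) ∈ v.asIdeal)
    (v0 : HeightOneSpectrum (𝓞 M)) (hv0 : v0 ∈ Γ)
    (ι : v0.adicCompletion M →+* Cp)
    (hSch : PadicSchanuel Cp) :
    ∀ σ : M →+* Cp,
      (ZpRankClosure p M Γ : ℤ) ≥
        (NumberField.Units.rank M : ℤ) -
          max (((sInf {k : ℕ | ∃ c : M ≃ₐ[ℚ] M, InducedByConj M c ∧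
            k = tcos M c (Jset M Cp (SpOfGamma M Cp Γ v0 ι) σ)} : ℕ) : ℤ) - 1) 0 := by
  intro σ
  obtain ⟨c, hc, ht⟩ := Nat.sInf_mem (s := {k : ℕ | ∃ c : M ≃ₐ[ℚ] M, InducedByConj M c ∧
    k = tcos M c (Jset M Cp (SpOfGamma M Cp Γ v0 ι) σ)})
    (exists_inducedByConj.elim fun c hc => ⟨_, c, hc, rfl⟩)
  have := rank_sub_le_zpRankClosure p M hpadic hiso hSch hΓp hv0 ι σ hc
  rw [ht]
  omega
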